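/- Let X be a real normed vector space, Θ a set, f : Θ → X → X, V : Θ → X → ℝ, and let α̲, αΔ : [0,∞) → [0,∞) be class-K∞ functions. Suppose for every θ ∈ Θ and x ∈ X: α̲(‖x‖) ≤ V(θ, x) and V(θ, f(θ, x)) − V(θ, x) ≤ −αΔ(‖x‖). Let (θ_k) and (x_k) satisfy x_{k+1} = f(θ_k, x_k) and V(θ_{k+1}, x_{k+1}) ≤ V(θ_k, x_{k+1}) for all k. Then x_k → 0 as k → ∞; i.e., the state of the closed-loop system with parameters updated subject to the safety check is asymptotically driven to the origin. -/

import Mathlib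

/-- A function `α : ℝ → ℝ` (viewed as a map `[0,∞) → [0,∞)`) is of class `K∞`:
continuous on `[0,∞)`, strictly increasing on `[0,∞)`, `α 0 = 0`, nonnegative on `[0,∞)`,
and tending to `∞` at `∞`. -/
def IsClassKInf (α : ℝ → ℝ) : Prop :=
  ContinuousOn α (Set.Ici 0) ∧ StrictMonoOn α (Set.Ici 0) ∧ α 0 = 0 ∧
    (∀ r, 0 ≤ r → 0 ≤ α r) ∧ Filter.Tendsto α Filter.atTop Filter.atTop

/-- A sequence in `[0,∞)` tends to `0` as soon as its image under a class-`K∞` function does. -/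
theorem IsClassKInf.tendsto_zero_of_comp {α : ℝ → ℝ} (hα : IsClassKInf α) {u : ℕ → ℝ}
    (hu : ∀ k, 0 ≤ u k) (h : Filter.Tendsto (fun k => α (u k)) Filter.atTop (nhds 0)) :
    Filter.Tendsto u Filter.atTop (nhds 0) := by
  obtain ⟨-, hmono, h0, -, -⟩ := hα
  refine tendsto_order.2 ⟨fun a ha => .of_forall fun k => ha.trans_le (hu k), fun ε hε => ?_⟩
  have hpos : 0 < α ε := h0 ▸ hmono Set.self_mem_Ici hε.le hε
  filter_upwards [h.eventually_lt_const hpos] with k hk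
  exact (hmono.lt_iff_lt (hu k) hε.le).1 hk

/-- If a nonnegative sequence decreases by at least `d k ≥ 0` at every step, then `d` tends
to `0`. -/
theorem tendsto_zero_of_le_sub_succ {w d : ℕ → ℝ} (hw : ∀ k, 0 ≤ w k) (hd : ∀ k, 0 ≤ d k)
    (h : ∀ k, d k ≤ w k - w (k + 1)) : Filter.Tendsto d Filter.atTop (nhds 0) := by
  have hanti : Antitone w := antitone_nat_of_succ_le fun k => sub_nonneg.1 ((hd k).trans (h k))
  have hlim := tendsto_atTop_ciInf hanti ⟨0, Set.forall_mem_range.2 hw⟩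
  have hdiff := hlim.sub (hlim.comp (Filter.tendsto_add_atTop_nat 1))
  rw [sub_self] at hdiff
  exact squeeze_zero hd h hdiff

/-- Asymptotic stability conclusion of Theorem 1: the state of the closed-loop system
with parameters updated subject to the safety check is driven to the origin. -/
theorem kalman_calibration_asymptotic_stability
    {X : Type*} [NormedAddCommGroup X] [NormedSpace ℝ X]
    {Θ : Type*}
    (f : Θ → X → X) (V : Θ → X → ℝ)
    (αlo αd : ℝ → ℝ)
    (hαlo : IsClassKInf αlo) (hαd : IsClassKInf αd)
    (hlower : ∀ θ : Θ, ∀ x : X, αlo ‖x‖ ≤ V θ x)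
    (hdecrease : ∀ θ : Θ, ∀ x : X, V θ (f θ x) - V θ x ≤ -αd ‖x‖)
    (θseq : ℕ → Θ) (xseq : ℕ → X)
    (hstep : ∀ k : ℕ, xseq (k + 1) = f (θseq k) (xseq k))
    (hsafe : ∀ k : ℕ, V (θseq (k + 1)) (xseq (k + 1)) ≤ V (θseq k) (xseq (k + 1))) :
    Filter.Tendsto xseq Filter.atTop (nhds 0) := by
  have hαd_nonneg : ∀ k, 0 ≤ αd ‖xseq k‖ := fun k => hαd.2.2.2.1 _ (norm_nonneg _)
  have hV_nonneg : ∀ k, 0 ≤ V (θseq k) (xseq k) := fun k =>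
    (hαlo.2.2.2.1 _ (norm_nonneg _)).trans (hlower _ _)
  refine tendsto_zero_iff_norm_tendsto_zero.2
    (hαd.tendsto_zero_of_comp (fun k => norm_nonneg _)
      (tendsto_zero_of_le_sub_succ hV_nonneg hαd_nonneg fun k => ?_))
  have hdec := hdecrease (θseq k) (xseq k)
  rw [← hstep k] at hdec
  linarith [hsafe k]
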